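/- Discrete trace conservation for the semiclassical Hermite–Galerkin system (Proposition 3.2 (i), trace part): let V : ℝ → ℝ be smooth with all derivatives of order ≥ 2 bounded, let N ∈ ℕ be even, and let (R_k)_{k=0}^N be a strong solution of the semiclassical Hermite–Galerkin system of size N. Then the quantity T(t) := Σ_{k=0}^N (H_k(0)/√(2^k k!)) ∫_ℝ R_k(t,x) dx is independent of t, i.e. T(t) = T(0) for all t ≥ 0. -/

import Mathlib

open MeasureTheory

noncomputable section

/-- Mixed partial derivative `∂_x^b ∂_y^β` of a function `f(x,y)`. -/
def pd2 (b β : ℕ) (f : ℝ → ℝ → ℂ) (x y : ℝ) : ℂ :=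
  iteratedDeriv b (fun x' => iteratedDeriv β (fun y' => f x' y') y) x

/-- Weighted derivative `x^a ∂_x^b y^α ∂_y^β` of `f(x,y)`. -/
def wD (a b α β : ℕ) (f : ℝ → ℝ → ℂ) (x y : ℝ) : ℂ :=
  (x : ℂ) ^ a * (y : ℂ) ^ α * pd2 b β f x y

/-- Uncurried version of a two-variable function. -/
def unc (f : ℝ → ℝ → ℂ) : ℝ × ℝ → ℂ := fun p => f p.1 p.2

/-- L² norm over ℝ². -/
def L2 (f : ℝ → ℝ → ℂ) : ℝ := (eLpNorm (unc f) 2 (volume : Measure (ℝ × ℝ))).toReal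

/-- L² norm over ℝ. -/
def L2one (f : ℝ → ℂ) : ℝ := (eLpNorm f 2 (volume : Measure ℝ)).toReal

/-- Schwartz-class predicate for smooth functions of two real variables. -/
def IsSchwartz2 (f : ℝ → ℝ → ℂ) : Prop :=
  ContDiff ℝ (⊤ : ℕ∞) (unc f) ∧
    ∀ k n : ℕ, ∃ C : ℝ, ∀ p : ℝ × ℝ, ‖p‖ ^ k * ‖iteratedFDeriv ℝ n (unc f) p‖ ≤ C

/-- Schwartz-class predicate for smooth functions of one real variable. -/
def IsSchwartz1 (f : ℝ → ℂ) : Prop :=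
  ContDiff ℝ (⊤ : ℕ∞) f ∧ ∀ k n : ℕ, ∃ C : ℝ, ∀ x : ℝ, |x| ^ k * ‖iteratedDeriv n f x‖ ≤ C

/-- Time derivative of a time-dependent two-variable function. -/
def dtR (R : ℝ → ℝ → ℝ → ℂ) (t x y : ℝ) : ℂ := deriv (fun s => R s x y) t

/-- For all `a b α β`, the map `t ↦ x^a ∂_x^b y^α ∂_y^β R(t,·,·)` is continuously
differentiable from `[0,∞)` into `L²(ℝ²)` with derivative `x^a ∂_x^b y^α ∂_y^β ∂_t R(t,·,·)`. -/
def C1intoL2 (R : ℝ → ℝ → ℝ → ℂ) : Prop :=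
  ∀ a b α β : ℕ, ∃ Ψ Ψ' : ℝ → Lp ℂ 2 (volume : Measure (ℝ × ℝ)),
    (∀ t : ℝ, 0 ≤ t → (Ψ t : ℝ × ℝ → ℂ) =ᵐ[volume] unc (wD a b α β (R t))) ∧
    (∀ t : ℝ, 0 ≤ t → (Ψ' t : ℝ × ℝ → ℂ) =ᵐ[volume] unc (wD a b α β (dtR R t))) ∧
    (∀ t : ℝ, 0 ≤ t → HasDerivWithinAt Ψ (Ψ' t) (Set.Ici 0) t) ∧
    ContinuousOn Ψ' (Set.Ici 0)

/-- Regularity part of the notion of strong solution on `[0,∞) × ℝ²`. -/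
def IsRegularSol (R : ℝ → ℝ → ℝ → ℂ) : Prop :=
  ContDiffOn ℝ (⊤ : ℕ∞) (fun p : ℝ × ℝ × ℝ => R p.1 p.2.1 p.2.2) {p : ℝ × ℝ × ℝ | 0 ≤ p.1} ∧
  (∀ t : ℝ, 0 ≤ t → IsSchwartz2 (R t)) ∧ C1intoL2 R

/-- Strong solution of the von Neumann equation in Weyl variables. -/
def IsVNSol (hbar : ℝ) (V : ℝ → ℝ) (R : ℝ → ℝ → ℝ → ℂ) : Prop :=
  IsRegularSol R ∧
  ∀ t : ℝ, 0 ≤ t → ∀ x y : ℝ,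
    dtR R t x y = Complex.I * pd2 1 1 (R t) x y -
      Complex.I * (((V (x + hbar * y / 2) - V (x - hbar * y / 2)) / hbar : ℝ) : ℂ) * R t x y

/-- Strong solution of the semiclassical equation. -/
def IsSCSol (V : ℝ → ℝ) (R : ℝ → ℝ → ℝ → ℂ) : Prop :=
  IsRegularSol R ∧
  ∀ t : ℝ, 0 ≤ t → ∀ x y : ℝ,
    dtR R t x y = Complex.I * pd2 1 1 (R t) x y -
      Complex.I * ((deriv V x * y : ℝ) : ℂ) * R t x y

/-- The weighted Sobolev functional `𝒩_m` applied to a function of `(x,y)`. -/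
def NN (m : ℕ) (f : ℝ → ℝ → ℂ) : ℝ :=
  ∑ q ∈ Finset.filter
      (fun q : ℕ × ℕ × ℕ × ℕ => q.1 + q.2.1 + q.2.2.1 + q.2.2.2 ≤ m)
      (Finset.range (m+1) ×ˢ Finset.range (m+1) ×ˢ Finset.range (m+1) ×ˢ Finset.range (m+1)),
    L2 (wD q.1 q.2.1 q.2.2.1 q.2.2.2 f)

/-- Supremum norm of a real-valued function. -/
def supN (f : ℝ → ℝ) : ℝ := ⨆ x : ℝ, |f x|

/-- The constant `C_m[V]`. -/
def CmV (m : ℕ) (V : ℝ → ℝ) : ℝ :=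
  ((m : ℝ)^2 + 2*m + m * supN (iteratedDeriv 2 V) + m * |deriv V 0|) +
    2^m * (1+m) * m * (⨆ n ∈ Finset.Icc 2 (m+1), supN (iteratedDeriv n V))

/-- Physicists' Hermite polynomial. -/
def Hpoly (k : ℕ) (y : ℝ) : ℝ :=
  (-1)^k * Real.exp (y^2) * iteratedDeriv k (fun z => Real.exp (-z^2)) y

/-- Hermite function `Φ_k`. -/
def Φh (k : ℕ) (y : ℝ) : ℝ :=
  ((2:ℝ)^k * (Nat.factorial k : ℝ) * Real.sqrt Real.pi) ^ (-(1:ℝ)/2) *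
    Real.exp (-y^2/2) * Hpoly k y

/-- The operator `𝒟 u = ∂_x u + V'(x) u`. -/
def Dop (V : ℝ → ℝ) (u : ℝ → ℂ) (x : ℝ) : ℂ := deriv u x + ((deriv V x : ℝ) : ℂ) * u x

/-- The operator `𝒟* u = −∂_x u + V'(x) u`. -/
def Dstar (V : ℝ → ℝ) (u : ℝ → ℂ) (x : ℝ) : ℂ := -deriv u x + ((deriv V x : ℝ) : ℂ) * u x

/-- The quantum correction `ℰ^ħ(x,y)`. -/
def Eh (hbar : ℝ) (V : ℝ → ℝ) (x y : ℝ) : ℝ :=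
  (V (x + hbar * y / 2) - V (x - hbar * y / 2)) / hbar - deriv V x * y

/-- Matrix elements `ℰ^ħ_{k,l}(x)` of the quantum correction. -/
def Ekl (hbar : ℝ) (V : ℝ → ℝ) (k l : ℕ) (x : ℝ) : ℝ :=
  ∫ y : ℝ, Eh hbar V x y * Φh k y * Φh l y

/-- `t ↦ u(t,·)` is continuously differentiable from `[0,∞)` into `L²(ℝ)` with
derivative `∂_t u`. -/
def C1intoL2one (u : ℝ → ℝ → ℂ) : Prop :=
  ∃ Ψ Ψ' : ℝ → Lp ℂ 2 (volume : Measure ℝ),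
    (∀ t : ℝ, 0 ≤ t → (Ψ t : ℝ → ℂ) =ᵐ[volume] u t) ∧
    (∀ t : ℝ, 0 ≤ t → (Ψ' t : ℝ → ℂ) =ᵐ[volume] fun x => deriv (fun s => u s x) t) ∧
    (∀ t : ℝ, 0 ≤ t → HasDerivWithinAt Ψ (Ψ' t) (Set.Ici 0) t) ∧
    ContinuousOn Ψ' (Set.Ici 0)

/-- Regularity part of the notion of strong solution of a Hermite–Galerkin system of size `N`;
the convention `R_k = 0` for `k > N` is included. -/
def IsGalerkinReg (N : ℕ) (R : ℕ → ℝ → ℝ → ℂ) : Prop :=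
  (∀ k, k ≤ N → ContDiffOn ℝ (⊤ : ℕ∞) (fun p : ℝ × ℝ => R k p.1 p.2) {p : ℝ × ℝ | 0 ≤ p.1}) ∧
  (∀ k, k ≤ N → ∀ t : ℝ, 0 ≤ t → IsSchwartz1 (R k t)) ∧
  (∀ k, k ≤ N → C1intoL2one (R k)) ∧
  (∀ k, N < k → ∀ t x : ℝ, R k t x = 0)

/-- Strong solution of the semiclassical Hermite–Galerkin system of size `N`.
(For `k = 0` the coefficient `√(k/2)` vanishes, so the term `R_{k-1}` is harmless.) -/
def IsSCGalerkinSol (V : ℝ → ℝ) (N : ℕ) (R : ℕ → ℝ → ℝ → ℂ) : Prop :=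
  IsGalerkinReg N R ∧
  ∀ k, k ≤ N → ∀ t : ℝ, 0 ≤ t → ∀ x : ℝ,
    deriv (fun s => R k s x) t +
      Complex.I * ((Real.sqrt ((k : ℝ)/2) : ℂ) * Dop V (R (k-1) t) x +
        (Real.sqrt (((k : ℝ)+1)/2) : ℂ) * Dstar V (R (k+1) t) x) = 0

/-- Strong solution of the von Neumann Hermite–Galerkin system of size `N`. -/
def IsVNGalerkinSol (hbar : ℝ) (V : ℝ → ℝ) (N : ℕ) (R : ℕ → ℝ → ℝ → ℂ) : Prop :=
  IsGalerkinReg N R ∧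
  ∀ k, k ≤ N → ∀ t : ℝ, 0 ≤ t → ∀ x : ℝ,
    deriv (fun s => R k s x) t +
      Complex.I * ((Real.sqrt ((k : ℝ)/2) : ℂ) * Dop V (R (k-1) t) x +
        (Real.sqrt (((k : ℝ)+1)/2) : ℂ) * Dstar V (R (k+1) t) x) =
      -Complex.I * ∑ l ∈ Finset.range (N+1), ((Ekl hbar V k l x : ℝ) : ℂ) * R l t x

/-- Smooth potential with all derivatives of order `≥ 2` bounded. -/
def SmoothBounded (V : ℝ → ℝ) : Prop :=
  ContDiff ℝ (⊤ : ℕ∞) V ∧ ∀ n : ℕ, 2 ≤ n → ∃ C : ℝ, ∀ x : ℝ, |iteratedDeriv n V x| ≤ C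

/-- The harmonic-oscillator operator `A G = y² G − G''`. -/
def Aop (g : ℝ → ℂ) : ℝ → ℂ := fun y => (y : ℂ)^2 * g y - iteratedDeriv 2 g y

section

open MeasureTheory Filter Topology Set

/-! ### Hermite polynomials at the origin -/

lemma Hpoly_zero_eq (k : ℕ) :
    Hpoly k 0 = Real.sqrt 2 ^ k * ((Polynomial.hermite k).coeff 0 : ℝ) := by
  have hg : ContDiff ℝ (k : WithTop ℕ∞) (fun y : ℝ => Real.exp (-(y ^ 2 / 2))) := by fun_prop
  have h := congrFun (iteratedDeriv_comp_const_mul hg (Real.sqrt 2)) 0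
  have hf : (fun x : ℝ => Real.exp (-((Real.sqrt 2 * x) ^ 2 / 2)))
      = fun z : ℝ => Real.exp (-z ^ 2) := by
    funext x
    rw [mul_pow, Real.sq_sqrt (by norm_num)]
    congr 1
    ring
  rw [hf] at h
  rw [Hpoly, h, iteratedDeriv_eq_iterate, Polynomial.deriv_gaussian_eq_hermite_mul_gaussian,
    mul_zero, ← Polynomial.coeff_zero_eq_aeval_zero']
  simp only [ne_eq, OfNat.ofNat_ne_zero, not_false_eq_true, zero_pow, Real.exp_zero, mul_one,
    zero_div, neg_zero, eq_intCast]
  have h1 : ((-1 : ℝ) ^ k) * (-1) ^ k = 1 := by rw [← mul_pow]; simp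
  linear_combination (Real.sqrt 2 ^ k * ((Polynomial.hermite k).coeff 0 : ℝ)) * h1

lemma Hpoly_zero_of_odd {k : ℕ} (hk : Odd k) : Hpoly k 0 = 0 := by
  rw [Hpoly_zero_eq, Polynomial.coeff_hermite_of_odd_add (by simpa using hk)]
  simp

lemma Hpoly_zero_add_two (k : ℕ) : Hpoly (k + 2) 0 = -(2 * (k + 1)) * Hpoly k 0 := by
  rcases Nat.even_or_odd k with ⟨n, rfl⟩ | hk
  · have h1 := Polynomial.coeff_hermite_explicit n 0
    have h2 := Polynomial.coeff_hermite_explicit (n + 1) 0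
    have e : 2 * (n + 1) - 1 = 2 * n + 1 := by omega
    rw [e] at h2
    have e' : (2 * n + 1).doubleFactorial = (2 * n + 1) * (2 * n - 1).doubleFactorial := by
      cases n with
      | zero => rfl
      | succ m => exact Nat.doubleFactorial_add_two (2 * m + 1)
    rw [e'] at h2
    simp only [add_zero, Nat.choose_zero_right, Nat.cast_one, mul_one] at h1 h2
    rw [Hpoly_zero_eq, Hpoly_zero_eq, show n + n + 2 = 2 * (n + 1) by ring,
      show n + n = 2 * n by ring, h1, h2, show 2 * (n + 1) = 2 * n + 2 by ring, pow_add,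
      Real.sq_sqrt (by norm_num)]
    push_cast
    ring
  · rw [Hpoly_zero_of_odd hk, Hpoly_zero_of_odd (by simpa [Nat.odd_add] using hk)]
    simp

/-- The normalised trace weight `H_k(0) / √(2^k k!)`. -/
def traceWeight (k : ℕ) : ℝ := Hpoly k 0 / Real.sqrt (2 ^ k * (Nat.factorial k : ℝ))

lemma traceWeight_of_odd {k : ℕ} (hk : Odd k) : traceWeight k = 0 := by
  simp [traceWeight, Hpoly_zero_of_odd hk]

lemma traceWeight_add_two (k : ℕ) :
    traceWeight (k + 2) * Real.sqrt (((k + 2 : ℕ) : ℝ) / 2)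
      = -(traceWeight k * Real.sqrt (((k : ℝ) + 1) / 2)) := by
  have hA : 0 < Real.sqrt (2 ^ k * (Nat.factorial k : ℝ)) := by positivity
  have hB : 0 < Real.sqrt ((k : ℝ) + 1) := by positivity
  have hC : 0 < Real.sqrt ((k : ℝ) + 2) := by positivity
  have h2 : 0 < Real.sqrt 2 := by positivity
  have e : Real.sqrt (2 ^ (k + 2) * (Nat.factorial (k + 2) : ℝ))
      = 2 * Real.sqrt ((k : ℝ) + 2) * Real.sqrt ((k : ℝ) + 1)
        * Real.sqrt (2 ^ k * (Nat.factorial k : ℝ)) := by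
    rw [Real.sqrt_eq_iff_mul_self_eq (by positivity) (by positivity)]
    symm
    have a1 := Real.mul_self_sqrt (show 0 ≤ 2 ^ k * (Nat.factorial k : ℝ) by positivity)
    have a2 := Real.mul_self_sqrt (show 0 ≤ (k : ℝ) + 1 by positivity)
    have a3 := Real.mul_self_sqrt (show 0 ≤ (k : ℝ) + 2 by positivity)
    calc _ = 4 * (Real.sqrt ((k : ℝ) + 2) * Real.sqrt ((k : ℝ) + 2))
          * (Real.sqrt ((k : ℝ) + 1) * Real.sqrt ((k : ℝ) + 1))
          * (Real.sqrt (2 ^ k * (Nat.factorial k : ℝ))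
            * Real.sqrt (2 ^ k * (Nat.factorial k : ℝ))) := by ring
      _ = _ := by
        rw [a1, a2, a3, Nat.factorial_succ, Nat.factorial_succ]
        push_cast
        ring
  rw [traceWeight, traceWeight, e, Hpoly_zero_add_two, Real.sqrt_div (by positivity),
    Real.sqrt_div (by positivity)]
  push_cast
  have a2 := Real.sq_sqrt (show 0 ≤ (k : ℝ) + 1 by positivity)
  field_simp
  rw [a2]
  ring

/-- Truncated sums of the multiplication operator tested against the trace weights telescope. -/
lemma sum_range_traceWeight (r : ℕ → ℂ) (n : ℕ) :
    ∑ k ∈ Finset.range (n + 2), (traceWeight k : ℂ) *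
        ((Real.sqrt ((k : ℝ) / 2) : ℂ) * r (k - 1) + (Real.sqrt (((k : ℝ) + 1) / 2) : ℂ) * r (k + 1))
      = (traceWeight (n + 1) : ℂ) * (Real.sqrt (((n + 1 : ℕ) : ℝ) / 2 + 1 / 2) : ℂ) * r (n + 2)
        + (traceWeight n : ℂ) * (Real.sqrt (((n : ℝ) + 1) / 2) : ℂ) * r (n + 1) := by
  induction n with
  | zero =>
    rw [Finset.sum_range_succ, Finset.sum_range_one, zero_add,
      traceWeight_of_odd (by decide : Odd 1)]
    simp [mul_assoc]
  | succ m ih =>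
    have h : (traceWeight (m + 2) : ℂ) * (Real.sqrt (((m + 2 : ℕ) : ℝ) / 2) : ℂ)
        = -((traceWeight m : ℂ) * (Real.sqrt (((m : ℝ) + 1) / 2) : ℂ)) := by
      exact_mod_cast traceWeight_add_two m
    rw [Finset.sum_range_succ, ih]
    have e1 : ((m + 1 : ℕ) : ℝ) / 2 + 1 / 2 = (((m + 1 : ℕ) : ℝ) + 1) / 2 := by ring
    have e2 : ((m + 1 + 1 : ℕ) : ℝ) / 2 + 1 / 2 = (((m + 2 : ℕ) : ℝ) + 1) / 2 := by
      push_cast; ring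
    rw [e1, e2]
    simp only [show m + 1 + 1 = m + 2 by ring, show m + 2 - 1 = m + 1 by omega,
      show m + 1 + 2 = m + 2 + 1 by ring]
    linear_combination r (m + 1) * h

lemma sum_range_traceWeight_eq_zero {N : ℕ} (hN : Even N) (r : ℕ → ℂ) (hr : r (N + 1) = 0) :
    ∑ k ∈ Finset.range (N + 1), (traceWeight k : ℂ) *
        ((Real.sqrt ((k : ℝ) / 2) : ℂ) * r (k - 1) + (Real.sqrt (((k : ℝ) + 1) / 2) : ℂ) * r (k + 1))
      = 0 := by
  cases N with
  | zero => simp [show r 1 = 0 from hr]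
  | succ n =>
    rw [sum_range_traceWeight, show n + 2 = n + 1 + 1 by ring, hr,
      traceWeight_of_odd (k := n) (by simpa [Nat.even_add_one] using hN)]
    simp

/-! ### Conservation of the integral for equations in divergence form -/

lemma IsSchwartz1.integrable {f : ℝ → ℂ} (hf : IsSchwartz1 f) : Integrable f :=
  SchwartzMap.integrable (μ := volume)
    { toFun := f
      smooth' := hf.1
      decay' := fun k n => by
        obtain ⟨C, hC⟩ := hf.2 k n
        exact ⟨C, fun x => by simpa [norm_iteratedFDeriv_eq_norm_iteratedDeriv] using hC x⟩ }

lemma exists_contDiff_cutoff : ∃ φ : ℝ → ℝ, ContDiff ℝ 1 φ ∧ HasCompactSupport φ ∧ φ 0 = 1 ∧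
    ∀ x, |φ x| ≤ 1 := by
  let φ : ContDiffBump (0 : ℝ) := ⟨1, 2, by norm_num, by norm_num⟩
  refine ⟨φ, φ.contDiff, φ.hasCompactSupport, φ.one_of_mem_closedBall (by simp [φ.rIn_pos.le]), ?_⟩
  intro x
  rw [abs_of_nonneg φ.nonneg]
  exact φ.le_one

/-- A continuous, compactly supported real function as an element of complex `L²`. -/
def toLpTwo (χ : ℝ → ℝ) (h : Continuous χ) (h' : HasCompactSupport χ) :
    Lp ℂ 2 (volume : Measure ℝ) :=
  ((Complex.continuous_ofReal.comp h).memLp_of_hasCompactSupport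
    (h'.comp_left (g := Complex.ofReal) Complex.ofReal_zero)).toLp (fun x => (χ x : ℂ))

lemma inner_toLpTwo {χ : ℝ → ℝ} (h : Continuous χ) (h' : HasCompactSupport χ)
    {Ψ : Lp ℂ 2 (volume : Measure ℝ)} {f : ℝ → ℂ} (hf : Ψ =ᵐ[volume] f) :
    inner ℂ (toLpTwo χ h h') Ψ = ∫ x, (χ x : ℂ) * f x := by
  rw [L2.inner_def]
  refine integral_congr_ae ?_
  filter_upwards [hf, MemLp.coeFn_toLp ((Complex.continuous_ofReal.comp h).memLp_of_hasCompactSupport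
    (p := 2) (μ := volume) (h'.comp_left (g := Complex.ofReal) Complex.ofReal_zero))] with x h1 h2
  have h3 : (toLpTwo χ h h' : ℝ → ℂ) x = (χ x : ℂ) := h2
  rw [h1, h3, RCLike.inner_apply, Complex.conj_ofReal, mul_comm]

lemma norm_toLpTwo {χ : ℝ → ℝ} (h : Continuous χ) (h' : HasCompactSupport χ) :
    ‖toLpTwo χ h h'‖ = Real.sqrt (∫ x, χ x ^ 2) := by
  have h1 : inner ℂ (toLpTwo χ h h') (toLpTwo χ h h') = ((∫ x, χ x ^ 2 : ℝ) : ℂ) := by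
    rw [inner_toLpTwo h h' (Ψ := toLpTwo χ h h') (f := fun x => (χ x : ℂ)) (MemLp.coeFn_toLp _), ← integral_complex_ofReal]
    refine integral_congr_ae (Eventually.of_forall fun x => ?_)
    simp [sq]
  rw [@norm_eq_sqrt_re_inner ℂ, h1]
  simp

lemma integral_cutoff_mul_deriv {χ : ℝ → ℝ} (h : ContDiff ℝ 1 χ) (h' : HasCompactSupport χ)
    {q : ℝ → ℂ} (hq : ContDiff ℝ 1 q) :
    ∫ x, (χ x : ℂ) * deriv q x = -∫ x, ((deriv χ x : ℝ) : ℂ) * q x := by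
  have hd := h.continuous_deriv le_rfl
  have hc : HasCompactSupport fun x => (χ x : ℂ) := h'.comp_left (g := Complex.ofReal) (by simp)
  have hc' : HasCompactSupport fun x => ((deriv χ x : ℝ) : ℂ) :=
    h'.deriv.comp_left (g := Complex.ofReal) (by simp)
  have c1 : Continuous fun x => (χ x : ℂ) := Complex.continuous_ofReal.comp h.continuous
  have c2 : Continuous fun x => ((deriv χ x : ℝ) : ℂ) := Complex.continuous_ofReal.comp hd
  refine integral_mul_deriv_eq_deriv_mul_of_integrable
    (fun x _ => ((h.differentiable one_ne_zero) x).hasDerivAt.ofReal_comp)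
    (fun x _ => ((hq.differentiable one_ne_zero) x).hasDerivAt) ?_ ?_ ?_
  · exact (c1.mul (hq.continuous_deriv le_rfl)).integrable_of_hasCompactSupport hc.mul_right
  · exact (c2.mul hq.continuous).integrable_of_hasCompactSupport hc'.mul_right
  · exact (c1.mul hq.continuous).integrable_of_hasCompactSupport hc.mul_right

lemma tendsto_integral_dilated_mul {φ : ℝ → ℝ} (hφ : Continuous φ) (hφ0 : φ 0 = 1)
    (hφ1 : ∀ x, |φ x| ≤ 1) {c : ℕ → ℝ} (hc : Tendsto c atTop (𝓝 0)) {f : ℝ → ℂ}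
    (hf : Integrable f) :
    Tendsto (fun n => ∫ x, (φ (c n * x) : ℂ) * f x) atTop (𝓝 (∫ x, f x)) := by
  refine tendsto_integral_filter_of_dominated_convergence (fun x => ‖f x‖)
    (Eventually.of_forall fun n => ?_) (Eventually.of_forall fun n => ae_of_all _ fun x => ?_)
    hf.norm (ae_of_all _ fun x => ?_)
  · have hcont : Continuous fun x => (φ (c n * x) : ℂ) :=
      Complex.continuous_ofReal.comp (hφ.comp (by fun_prop))
    exact hcont.aestronglyMeasurable.mul hf.1
  · rw [norm_mul, Complex.norm_real]
    exact mul_le_of_le_one_left (norm_nonneg _) (hφ1 _)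
  · have h1 : Tendsto (fun n => φ (c n * x)) atTop (𝓝 1) := by
      have := (hφ.tendsto 0).comp (by simpa using hc.mul_const x)
      rwa [hφ0] at this
    simpa using ((Complex.continuous_ofReal.tendsto _).comp h1).mul_const (f x)

lemma integral_deriv_dilated_sq (φ : ℝ → ℝ) {c : ℝ} (hc : 0 < c) :
    ∫ x, deriv (fun y => φ (c * y)) x ^ 2 = c * ∫ x, deriv φ x ^ 2 := by
  have e : ∀ x, deriv (fun y => φ (c * y)) x ^ 2 = c ^ 2 * deriv φ (c * x) ^ 2 := by
    intro x
    rw [deriv_comp_mul_left, smul_eq_mul, mul_pow]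
  simp_rw [e]
  rw [integral_const_mul, Measure.integral_comp_mul_left (fun y => deriv φ y ^ 2),
    abs_of_pos (inv_pos.2 hc), smul_eq_mul, ← mul_assoc, sq, mul_assoc c c,
    mul_inv_cancel₀ hc.ne', mul_one]

lemma norm_integral_cutoff_sub_le {S Q : ℝ → ℝ → ℂ} {Ψ Ψ' Θ : ℝ → Lp ℂ 2 (volume : Measure ℝ)}
    (hQ : ∀ t, 0 ≤ t → ContDiff ℝ 1 (Q t))
    (hΨ : ∀ t, 0 ≤ t → Ψ t =ᵐ[volume] S t)
    (hΨ' : ∀ t, 0 ≤ t → Ψ' t =ᵐ[volume] deriv (Q t))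
    (hd : ∀ t, 0 ≤ t → HasDerivWithinAt Ψ (Ψ' t) (Ici 0) t)
    (hΘ : ∀ t, 0 ≤ t → Θ t =ᵐ[volume] Q t)
    {t M : ℝ} (ht : 0 ≤ t) (hM : ∀ s ∈ Icc 0 t, ‖Θ s‖ ≤ M)
    {χ : ℝ → ℝ} (h : ContDiff ℝ 1 χ) (h' : HasCompactSupport χ) :
    ‖(∫ x, (χ x : ℂ) * S t x) - ∫ x, (χ x : ℂ) * S 0 x‖
      ≤ Real.sqrt (∫ x, deriv χ x ^ 2) * M * t := by
  have hdc := h.continuous_deriv le_rfl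
  have H := (convex_Icc (0 : ℝ) t).norm_image_sub_le_of_norm_hasDerivWithin_le
    (f := fun s => inner ℂ (toLpTwo χ h.continuous h') (Ψ s))
    (f' := fun s => inner ℂ (toLpTwo χ h.continuous h') (Ψ' s))
    (C := Real.sqrt (∫ x, deriv χ x ^ 2) * M)
    (x := 0) (y := t) ?_ ?_ (left_mem_Icc.2 ht) (right_mem_Icc.2 ht)
  · rw [inner_toLpTwo _ _ (hΨ t ht), inner_toLpTwo _ _ (hΨ 0 le_rfl)] at H
    simpa [abs_of_nonneg ht] using H
  · intro s hs
    have := (hasDerivWithinAt_const s (Ici (0 : ℝ)) (toLpTwo χ h.continuous h')).inner ℂ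
      (hd s hs.1)
    simpa using this.mono Icc_subset_Ici_self
  · intro s hs
    rw [inner_toLpTwo _ _ (hΨ' s hs.1), integral_cutoff_mul_deriv h h' (hQ s hs.1), norm_neg,
      ← inner_toLpTwo hdc h'.deriv (hΘ s hs.1), ← norm_toLpTwo hdc h'.deriv]
    exact (norm_inner_le_norm _ _).trans
      (mul_le_mul_of_nonneg_left (hM s hs) (norm_nonneg _))

/-- The integral is conserved by `∂_t S = ∂_x Q` when the time derivative of `S` is taken in `L²`
and the flux `Q` is continuous in time with values in `L²`. -/
theorem integral_eq_of_deriv_flux {S Q : ℝ → ℝ → ℂ} {Ψ Ψ' Θ : ℝ → Lp ℂ 2 (volume : Measure ℝ)}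
    (hS : ∀ t, 0 ≤ t → Integrable (S t)) (hQ : ∀ t, 0 ≤ t → ContDiff ℝ 1 (Q t))
    (hΨ : ∀ t, 0 ≤ t → Ψ t =ᵐ[volume] S t)
    (hΨ' : ∀ t, 0 ≤ t → Ψ' t =ᵐ[volume] deriv (Q t))
    (hd : ∀ t, 0 ≤ t → HasDerivWithinAt Ψ (Ψ' t) (Ici 0) t)
    (hΘ : ∀ t, 0 ≤ t → Θ t =ᵐ[volume] Q t) (hΘc : ContinuousOn Θ (Ici 0))
    {t : ℝ} (ht : 0 ≤ t) : ∫ x, S t x = ∫ x, S 0 x := by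
  obtain ⟨M, hM⟩ := isCompact_Icc.exists_bound_of_continuousOn
    (hΘc.mono (Icc_subset_Ici_self : Icc 0 t ⊆ Ici 0))
  obtain ⟨φ, hφ, hφs, hφ0, hφ1⟩ := exists_contDiff_cutoff
  obtain ⟨c, hcpos, hc⟩ : ∃ c : ℕ → ℝ, (∀ n, 0 < c n) ∧ Tendsto c atTop (𝓝 0) :=
    ⟨fun n => 1 / ((n : ℝ) + 1), fun n => by positivity, tendsto_one_div_add_atTop_nhds_zero_nat⟩
  have hbound : ∀ n, ‖(∫ x, (φ (c n * x) : ℂ) * S t x) - ∫ x, (φ (c n * x) : ℂ) * S 0 x‖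
      ≤ Real.sqrt (c n * ∫ x, deriv φ x ^ 2) * M * t := by
    intro n
    rw [← integral_deriv_dilated_sq φ (hcpos n)]
    have h1 : ContDiff ℝ 1 fun x => φ (c n * x) := by fun_prop
    have h2 : HasCompactSupport fun x => φ (c n * x) := by
      simpa only [smul_eq_mul] using hφs.comp_smul (hcpos n).ne'
    exact norm_integral_cutoff_sub_le hQ hΨ hΨ' hd hΘ ht hM h1 h2
  have hzero : Tendsto (fun n => Real.sqrt (c n * ∫ x, deriv φ x ^ 2) * M * t) atTop (𝓝 0) := by
    have := (((Real.continuous_sqrt.tendsto _).comp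
      (hc.mul_const (∫ x, deriv φ x ^ 2))).mul_const M).mul_const t
    simpa using this
  have hlim := fun {f : ℝ → ℂ} =>
    tendsto_integral_dilated_mul (f := f) hφ.continuous hφ0 hφ1 hc
  have h0 := squeeze_zero_norm hbound hzero
  exact sub_eq_zero.1 (tendsto_nhds_unique ((hlim (hS t ht)).sub (hlim (hS 0 le_rfl))) h0)

lemma coeFn_sum_smul_ae {s : Finset ℕ} (a : ℕ → ℂ) {Ψ : ℕ → Lp ℂ 2 (volume : Measure ℝ)}
    {f : ℕ → ℝ → ℂ} (h : ∀ k, Ψ k =ᵐ[volume] f k) :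
    (∑ k ∈ s, a k • Ψ k : Lp ℂ 2 (volume : Measure ℝ)) =ᵐ[volume]
      fun x => ∑ k ∈ s, a k * f k x := by
  induction s using Finset.induction_on with
  | empty =>
    simp only [Finset.sum_empty]
    exact Lp.coeFn_zero ℂ 2 (volume : Measure ℝ)
  | insert i s hi ih =>
    rw [Finset.sum_insert hi]
    filter_upwards [Lp.coeFn_add (a i • Ψ i) (∑ k ∈ s, a k • Ψ k), Lp.coeFn_smul (a i) (Ψ i), ih,
      h i] with x h1 h2 h3 h4
    rw [h1, Pi.add_apply, h2, Pi.smul_apply, h3, h4, Finset.sum_insert hi, smul_eq_mul]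

lemma C1intoL2one_of_eq_zero {u : ℝ → ℝ → ℂ} (hu : ∀ t x, u t x = 0) : C1intoL2one u := by
  refine ⟨fun _ => 0, fun _ => 0, fun t _ => ?_, fun t _ => ?_, fun t _ => ?_, continuousOn_const⟩
  · filter_upwards [Lp.coeFn_zero ℂ 2 (volume : Measure ℝ)] with x hx
    rw [hx, hu, Pi.zero_apply]
  · filter_upwards [Lp.coeFn_zero ℂ 2 (volume : Measure ℝ)] with x hx
    rw [hx]
    simp [hu]
  · exact hasDerivWithinAt_const _ _ _

/-- The flux `Q` for which `∂_t ∑ c_k R_k = ∂_x Q`, the `c_k` being the trace weights. -/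
def traceFlux (N : ℕ) (R : ℕ → ℝ → ℝ → ℂ) (t x : ℝ) : ℂ :=
  ∑ k ∈ Finset.range (N + 1), ((-Complex.I * traceWeight k * Real.sqrt ((k : ℝ) / 2)) * R (k - 1) t x
    + (Complex.I * traceWeight k * Real.sqrt (((k : ℝ) + 1) / 2)) * R (k + 1) t x)

lemma IsSCGalerkinSol.sum_deriv_eq_deriv_traceFlux {V : ℝ → ℝ} {N : ℕ} (hN : Even N)
    {R : ℕ → ℝ → ℝ → ℂ} (hR : IsSCGalerkinSol V N R) {t : ℝ} (ht : 0 ≤ t)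
    (hd : ∀ k, Differentiable ℝ (R k t)) (x : ℝ) :
    ∑ k ∈ Finset.range (N + 1), (traceWeight k : ℂ) * deriv (fun s => R k s x) t
      = deriv (traceFlux N R t) x := by
  have hflux : HasDerivAt (traceFlux N R t)
      (∑ k ∈ Finset.range (N + 1),
        ((-Complex.I * traceWeight k * Real.sqrt ((k : ℝ) / 2)) * deriv (R (k - 1) t) x
        + (Complex.I * traceWeight k * Real.sqrt (((k : ℝ) + 1) / 2)) * deriv (R (k + 1) t) x)) x :=
    HasDerivAt.fun_sum fun k _ =>
      ((hd _ x).hasDerivAt.const_mul _).add ((hd _ x).hasDerivAt.const_mul _)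
  have hz := sum_range_traceWeight_eq_zero hN (fun k => R k t x) (hR.1.2.2.2 _ N.lt_succ_self t x)
  rw [hflux.deriv, ← sub_eq_zero, ← Finset.sum_sub_distrib]
  have hz' := congrArg (fun z => -Complex.I * ((deriv V x : ℝ) : ℂ) * z) hz
  rw [Finset.mul_sum, mul_zero] at hz'
  rw [← hz']
  refine Finset.sum_congr rfl fun k hk => ?_
  have hk' := hR.2 k (Nat.lt_succ_iff.1 (Finset.mem_range.1 hk)) t ht x
  rw [Dop, Dstar] at hk'
  linear_combination (traceWeight k : ℂ) * hk'

end

/-- Discrete trace conservation for the semiclassical Hermite–Galerkin system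
(Proposition 3.2 (i), trace part). -/
theorem semiclassical_galerkin_trace_conservation (V : ℝ → ℝ) (hV : SmoothBounded V)
    (N : ℕ) (hN : Even N) (R : ℕ → ℝ → ℝ → ℂ) (hR : IsSCGalerkinSol V N R) :
    ∀ t : ℝ, 0 ≤ t →
      (∑ k ∈ Finset.range (N+1),
        ((Hpoly k 0 / Real.sqrt (2^k * (Nat.factorial k : ℝ)) : ℝ) : ℂ) * ∫ x : ℝ, R k t x) =
      ∑ k ∈ Finset.range (N+1),
        ((Hpoly k 0 / Real.sqrt (2^k * (Nat.factorial k : ℝ)) : ℝ) : ℂ) * ∫ x : ℝ, R k 0 x := by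
  intro t ht
  have hsmooth : ∀ k t, 0 ≤ t → IsSchwartz1 (R k t) := by
    intro k t ht
    by_cases hk : k ≤ N
    · exact hR.1.2.1 k hk t ht
    · have h0 : R k t = fun _ => 0 := funext (hR.1.2.2.2 k (not_le.1 hk) t)
      rw [h0]
      exact ⟨contDiff_const, fun _ n => ⟨0, fun x => by
        simp [show iteratedDeriv n (fun _ : ℝ => (0 : ℂ)) x = 0 by simp]⟩⟩
  have hC1 : ∀ k, C1intoL2one (R k) := by
    intro k
    by_cases hk : k ≤ N
    · exact hR.1.2.2.1 k hk
    · exact C1intoL2one_of_eq_zero (hR.1.2.2.2 k (not_le.1 hk))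
  have hR1 : ∀ k t, 0 ≤ t → ContDiff ℝ 1 (R k t) := fun k t ht =>
    (hsmooth k t ht).1.of_le (by exact_mod_cast le_top)
  choose Ψ Ψ' hΨ hΨ' hd _ using hC1
  have hsum : ∀ s, 0 ≤ s → ∑ k ∈ Finset.range (N + 1), (traceWeight k : ℂ) * ∫ x, R k s x
      = ∫ x, ∑ k ∈ Finset.range (N + 1), (traceWeight k : ℂ) * R k s x := by
    intro s hs
    rw [integral_finsetSum _ fun k _ => (hsmooth k s hs).integrable.const_mul _]
    simp_rw [integral_const_mul]
  have hΨc : ∀ k, ContinuousOn (Ψ k) (Set.Ici 0) := fun k s hs => (hd k s hs).continuousWithinAt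
  have hΨs : ∀ (a : ℂ) k, ContinuousOn (fun s => a • Ψ k s) (Set.Ici 0) := fun a k =>
    (hΨc k).const_smul a
  refine (hsum t ht).trans (Eq.trans ?_ (hsum 0 le_rfl).symm)
  refine integral_eq_of_deriv_flux
    (S := fun s x => ∑ k ∈ Finset.range (N + 1), (traceWeight k : ℂ) * R k s x)
    (Q := traceFlux N R)
    (Ψ := fun s => ∑ k ∈ Finset.range (N + 1), (traceWeight k : ℂ) • Ψ k s)
    (Ψ' := fun s => ∑ k ∈ Finset.range (N + 1), (traceWeight k : ℂ) • Ψ' k s)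
    (Θ := fun s =>
      ∑ k ∈ Finset.range (N + 1),
        (-Complex.I * traceWeight k * Real.sqrt ((k : ℝ) / 2)) • Ψ (k - 1) s +
      ∑ k ∈ Finset.range (N + 1),
        (Complex.I * traceWeight k * Real.sqrt (((k : ℝ) + 1) / 2)) • Ψ (k + 1) s)
    ?_ ?_ ?_ ?_ ?_ ?_ ?_ ht
  · exact fun s hs => integrable_finsetSum _ fun k _ => (hsmooth k s hs).integrable.const_mul _
  · exact fun s hs => ContDiff.sum fun k _ =>
      (contDiff_const.mul (hR1 _ s hs)).add (contDiff_const.mul (hR1 _ s hs))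
  · exact fun s hs => coeFn_sum_smul_ae _ fun k => hΨ k s hs
  · intro s hs
    filter_upwards [coeFn_sum_smul_ae (s := Finset.range (N + 1)) (fun k => (traceWeight k : ℂ))
      fun k => hΨ' k s hs] with x hx
    rw [hx]
    exact hR.sum_deriv_eq_deriv_traceFlux hN hs
      (fun k => (hR1 k s hs).differentiable one_ne_zero) x
  · exact fun s hs => HasDerivWithinAt.fun_sum fun k _ => (hd k s hs).fun_const_smul _
  · intro s hs
    filter_upwards [Lp.coeFn_add
        (∑ k ∈ Finset.range (N + 1),
          (-Complex.I * traceWeight k * Real.sqrt ((k : ℝ) / 2)) • Ψ (k - 1) s)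
        (∑ k ∈ Finset.range (N + 1),
          (Complex.I * traceWeight k * Real.sqrt (((k : ℝ) + 1) / 2)) • Ψ (k + 1) s),
      coeFn_sum_smul_ae (s := Finset.range (N + 1))
        (fun k => -Complex.I * traceWeight k * Real.sqrt ((k : ℝ) / 2))
        fun k => hΨ (k - 1) s hs,
      coeFn_sum_smul_ae (s := Finset.range (N + 1))
        (fun k => Complex.I * traceWeight k * Real.sqrt (((k : ℝ) + 1) / 2))
        fun k => hΨ (k + 1) s hs] with x h1 h2 h3
    rw [h1, Pi.add_apply, h2, h3, ← Finset.sum_add_distrib, traceFlux]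
  · exact (continuousOn_finsetSum _ fun k _ => hΨs _ (k - 1)).add
      (continuousOn_finsetSum _ fun k _ => hΨs _ (k + 1))

end
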